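/- Let 1 ≤ N ≤ 4 and let ω₁, ω₂ : ℝ^N → ℝ be smooth positive functions such that: ω₂ is bounded on ℝ^N; and there is a constant C > 0 with ω₁(x) ≤ C ω₂(x) and |∇ω₁(x)| ≤ C ω₂(x) for all x with |x| sufficiently large. Then there is no stable sub-solution of the equation −div(ω₁ ∇u) = ω₂ e^u in ℝ^N. -/

import Mathlib

open MeasureTheory Filter Real
open scoped RealInnerProductSpace

noncomputable def vdiv {N : ℕ} (V : EuclideanSpace ℝ (Fin N) → EuclideanSpace ℝ (Fin N))
    (x : EuclideanSpace ℝ (Fin N)) : ℝ :=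
  LinearMap.trace ℝ (EuclideanSpace ℝ (Fin N)) (fderiv ℝ V x).toLinearMap

def annulus (N : ℕ) (R : ℝ) : Set (EuclideanSpace ℝ (Fin N)) :=
  {x | R < ‖x‖ ∧ ‖x‖ < 2 * R}

variable {N : ℕ}

theorem ContDiff.gradient_right {f : EuclideanSpace ℝ (Fin N) → ℝ} {m n : WithTop ℕ∞}
    (hf : ContDiff ℝ n f) (h : m + 1 ≤ n) : ContDiff ℝ m (gradient f) :=
  (InnerProductSpace.toDual ℝ _).symm.contDiff.comp (hf.fderiv_right h)

theorem gradient_comp_const_smul (f : EuclideanSpace ℝ (Fin N) → ℝ) (c : ℝ) :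
    gradient (fun y => f (c • y)) = fun x => c • gradient f (c • x) := by
  ext1 x
  simp only [gradient, fderiv_comp_smul, map_smul]

theorem gradient_fun_mul {f g : EuclideanSpace ℝ (Fin N) → ℝ} {x : EuclideanSpace ℝ (Fin N)}
    (hf : DifferentiableAt ℝ f x) (hg : DifferentiableAt ℝ g x) :
    gradient (fun y => f y * g y) x = f x • gradient g x + g x • gradient f x := by
  simp only [gradient, fderiv_fun_mul hf hg, map_add, map_smul]

theorem gradient_fun_pow {f : EuclideanSpace ℝ (Fin N) → ℝ} {x : EuclideanSpace ℝ (Fin N)}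
    (hf : DifferentiableAt ℝ f x) (n : ℕ) :
    gradient (fun y => f y ^ n) x = (n * f x ^ (n - 1)) • gradient f x := by
  simp only [gradient, fderiv_fun_pow n hf, nsmul_eq_mul, map_smul]

theorem gradient_const_mul {f : EuclideanSpace ℝ (Fin N) → ℝ} {x : EuclideanSpace ℝ (Fin N)}
    (hf : DifferentiableAt ℝ f x) (c : ℝ) :
    gradient (fun y => c * f y) x = c • gradient f x := by
  simp only [gradient, fderiv_const_mul hf, map_smul]

theorem gradient_exp {f : EuclideanSpace ℝ (Fin N) → ℝ} {x : EuclideanSpace ℝ (Fin N)}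
    (hf : DifferentiableAt ℝ f x) :
    gradient (fun y => Real.exp (f y)) x = Real.exp (f x) • gradient f x := by
  simp only [gradient, fderiv_exp hf, map_smul]

theorem vdiv_eq_sum (V : EuclideanSpace ℝ (Fin N) → EuclideanSpace ℝ (Fin N))
    (x : EuclideanSpace ℝ (Fin N)) :
    vdiv V x = ∑ i, (fderiv ℝ V x (EuclideanSpace.single i 1)) i := by
  rw [vdiv, LinearMap.trace_eq_sum_inner _ (EuclideanSpace.basisFun (Fin N) ℝ)]
  simp [EuclideanSpace.inner_single_left]

theorem vdiv_fun_smul {f : EuclideanSpace ℝ (Fin N) → ℝ}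
    {V : EuclideanSpace ℝ (Fin N) → EuclideanSpace ℝ (Fin N)} {x : EuclideanSpace ℝ (Fin N)}
    (hf : DifferentiableAt ℝ f x) (hV : DifferentiableAt ℝ V x) :
    vdiv (fun y => f y • V y) x = f x * vdiv V x + ⟪gradient f x, V x⟫ := by
  have h : ((fderiv ℝ f x).smulRight (V x)).toLinearMap
      = (fderiv ℝ f x).toLinearMap.smulRight (V x) := rfl
  rw [vdiv, fderiv_fun_smul hf hV, ContinuousLinearMap.toLinearMap_add,
    ContinuousLinearMap.toLinearMap_smul, map_add, map_smul, h, LinearMap.trace_smulRight,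
    inner_gradient_left]
  rfl

theorem vdiv_eq_zero_of_eventuallyEq_zero
    {V : EuclideanSpace ℝ (Fin N) → EuclideanSpace ℝ (Fin N)} {x : EuclideanSpace ℝ (Fin N)}
    (h : V =ᶠ[nhds x] fun _ => 0) : vdiv V x = 0 := by
  rw [vdiv, h.fderiv_eq]
  simp

theorem vdiv_comp_const_smul (V : EuclideanSpace ℝ (Fin N) → EuclideanSpace ℝ (Fin N)) (c : ℝ)
    (x : EuclideanSpace ℝ (Fin N)) :
    vdiv (fun y => V (c • y)) x = c * vdiv V (c • x) := by
  rw [vdiv, fderiv_comp_smul, ContinuousLinearMap.toLinearMap_smul, map_smul]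
  rfl

theorem continuous_vdiv {V : EuclideanSpace ℝ (Fin N) → EuclideanSpace ℝ (Fin N)}
    (hV : ContDiff ℝ 1 V) : Continuous (vdiv V) := by
  have h := hV.continuous_fderiv one_ne_zero
  rw [show vdiv V = fun x => ∑ i, (fderiv ℝ V x (EuclideanSpace.single i 1)) i from
    funext (vdiv_eq_sum V)]
  fun_prop

theorem hasCompactSupport_vdiv {V : EuclideanSpace ℝ (Fin N) → EuclideanSpace ℝ (Fin N)}
    (hV : HasCompactSupport V) : HasCompactSupport (vdiv V) :=
  (hV.fderiv (𝕜 := ℝ)).mono fun x hx h => hx <| by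
    rw [vdiv, h]
    simp

theorem integral_fderiv_apply_eq_zero {g : EuclideanSpace ℝ (Fin N) → ℝ}
    (hg : ContDiff ℝ 1 g) (hc : HasCompactSupport g) (v : EuclideanSpace ℝ (Fin N)) :
    ∫ x, fderiv ℝ g x v = 0 := by
  have hi : Integrable fun x => fderiv ℝ g x v :=
    ((hg.continuous_fderiv one_ne_zero).clm_apply
      continuous_const).integrable_of_hasCompactSupport (hc.fderiv_apply (𝕜 := ℝ) v)
  have := integral_mul_fderiv_eq_neg_fderiv_mul_of_integrable (μ := volume) (f := fun _ => (1 : ℝ))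
    (g := g) (v := v) (by simp) (by simpa using hi)
    (by simpa using hg.continuous.integrable_of_hasCompactSupport hc)
    (fun x _ => differentiableAt_const _) (fun x _ => hg.differentiable one_ne_zero x)
  simpa using this

theorem integral_vdiv_eq_zero {V : EuclideanSpace ℝ (Fin N) → EuclideanSpace ℝ (Fin N)}
    (hV : ContDiff ℝ 1 V) (hc : HasCompactSupport V) : ∫ x, vdiv V x = 0 := by
  have hi (i : Fin N) : ContDiff ℝ 1 fun x => V x i := by fun_prop
  have hci (i : Fin N) : HasCompactSupport fun x => V x i :=
    hc.comp_left (g := fun y : EuclideanSpace ℝ (Fin N) => y i) rfl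
  have h (x : EuclideanSpace ℝ (Fin N)) :
      vdiv V x = ∑ i, fderiv ℝ (fun y => V y i) x (EuclideanSpace.single i 1) := by
    rw [vdiv_eq_sum]
    refine Finset.sum_congr rfl fun i _ => ?_
    have := ((EuclideanSpace.proj (𝕜 := ℝ) i).hasFDerivAt.comp x
      (hV.differentiable one_ne_zero x).hasFDerivAt).fderiv
    exact (congrArg (fun L => L (EuclideanSpace.single i 1)) this).symm
  simp_rw [h]
  rw [integral_finsetSum]
  · exact Finset.sum_eq_zero fun i _ => integral_fderiv_apply_eq_zero (hi i) (hci i) _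
  · exact fun i _ => (((hi i).continuous_fderiv one_ne_zero).clm_apply
      continuous_const).integrable_of_hasCompactSupport ((hci i).fderiv_apply (𝕜 := ℝ) _)

/-- Smooth cutoff functions at scale `R`, with derivatives of size `1 / R`. -/
theorem exists_cutoff (N : ℕ) : ∃ K : ℝ, 0 ≤ K ∧ ∀ R : ℝ, 1 ≤ R →
    ∃ η : EuclideanSpace ℝ (Fin N) → ℝ, ContDiff ℝ (⊤ : ℕ∞) η ∧ HasCompactSupport η ∧
      (∀ x, 0 ≤ η x ∧ η x ≤ 1) ∧ (∀ x, ‖x‖ ≤ R → η x = 1) ∧ (∀ x, 2 * R ≤ ‖x‖ → η x = 0) ∧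
      (∀ x, ‖gradient η x‖ ≤ K / R) ∧ (∀ x, |vdiv (gradient η) x| ≤ K / R) ∧
      (∀ x, ‖x‖ < R → gradient η x = 0 ∧ vdiv (gradient η) x = 0) := by
  let χ : ContDiffBump (0 : EuclideanSpace ℝ (Fin N)) := ⟨1, 2, one_pos, one_lt_two⟩
  have hχ : ContDiff ℝ (⊤ : ℕ∞) χ := χ.contDiff
  have hg : ContDiff ℝ 1 (gradient χ) := hχ.gradient_right (by norm_cast)
  have hgc : HasCompactSupport (gradient χ) :=
    (χ.hasCompactSupport.fderiv (𝕜 := ℝ)).comp_left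
      (g := (InnerProductSpace.toDual ℝ (EuclideanSpace ℝ (Fin N))).symm) (map_zero _)
  obtain ⟨K₁, hK₁⟩ := hgc.exists_bound_of_continuous hg.continuous
  obtain ⟨K₂, hK₂⟩ := (hasCompactSupport_vdiv hgc).exists_bound_of_continuous (continuous_vdiv hg)
  have hK : 0 ≤ max K₁ K₂ := ((norm_nonneg _).trans (hK₁ 0)).trans (le_max_left _ _)
  refine ⟨max K₁ K₂, hK, fun R hR => ?_⟩
  have hR0 : 0 < R := one_pos.trans_le hR
  have hRi : R⁻¹ ≤ 1 := inv_le_one_of_one_le₀ hR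
  have hnorm (x : EuclideanSpace ℝ (Fin N)) : ‖R⁻¹ • x‖ = ‖x‖ / R := by
    rw [norm_smul, Real.norm_of_nonneg (by positivity), inv_mul_eq_div]
  have hone (x : EuclideanSpace ℝ (Fin N)) (hx : ‖x‖ ≤ R) : χ (R⁻¹ • x) = 1 := by
    apply χ.one_of_mem_closedBall
    rw [mem_closedBall_zero_iff, hnorm]
    exact (div_le_one hR0).2 hx
  have hgrad : gradient (fun x => χ (R⁻¹ • x)) = fun x => R⁻¹ • gradient χ (R⁻¹ • x) :=
    gradient_comp_const_smul _ _
  have hev (x : EuclideanSpace ℝ (Fin N)) (hx : ‖x‖ < R) :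
      gradient (fun x => χ (R⁻¹ • x)) =ᶠ[nhds x] fun _ => 0 := by
    have h1 : (fun x => χ (R⁻¹ • x)) =ᶠ[nhds x] fun _ => (1 : ℝ) := by
      filter_upwards [(isOpen_lt continuous_norm continuous_const).mem_nhds hx] with y hy
      exact hone y (le_of_lt hy)
    exact h1.gradient.trans (.of_forall fun y => gradient_fun_const y 1)
  refine ⟨fun x => χ (R⁻¹ • x), hχ.comp (contDiff_const_smul _),
    χ.hasCompactSupport.comp_homeomorph (Homeomorph.smulOfNeZero R⁻¹ (by positivity)),
    fun x => ⟨χ.nonneg, χ.le_one⟩, hone, fun x hx => ?_, fun x => ?_, fun x => ?_,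
    fun x hx => ⟨(hev x hx).eq_of_nhds, vdiv_eq_zero_of_eventuallyEq_zero (hev x hx)⟩⟩
  · apply χ.zero_of_le_dist
    rw [dist_zero_right, hnorm]
    exact (le_div_iff₀ hR0).2 hx
  · rw [hgrad, norm_smul, Real.norm_of_nonneg (by positivity), inv_mul_eq_div]
    gcongr
    exact (hK₁ _).trans (le_max_left _ _)
  · have hd : Differentiable ℝ fun x => gradient χ (R⁻¹ • x) :=
      (hg.comp (contDiff_const_smul _)).differentiable one_ne_zero
    rw [hgrad, vdiv_fun_smul (differentiableAt_const _) (hd x), gradient_fun_const,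
      inner_zero_left, add_zero, vdiv_comp_const_smul, abs_mul, abs_mul,
      abs_of_nonneg (by positivity : 0 ≤ R⁻¹), inv_mul_eq_div]
    gcongr
    calc R⁻¹ * |vdiv (gradient χ) (R⁻¹ • x)| ≤ 1 * K₂ := by
          gcongr
          exact hK₂ _
      _ ≤ max K₁ K₂ := by rw [one_mul]; exact le_max_right _ _

theorem energy_identity {a e u η : EuclideanSpace ℝ (Fin N) → ℝ} (x : EuclideanSpace ℝ (Fin N))
    (ha : DifferentiableAt ℝ a x) (he : DifferentiableAt ℝ e x) (hη : DifferentiableAt ℝ η x)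
    (hau : DifferentiableAt ℝ (fun y => a y • gradient u y) x)
    (hgη : DifferentiableAt ℝ (gradient η) x)
    (heu : gradient e x = (7 / 4 * e x) • gradient u x) :
    a x * ‖gradient (fun y => e y * η y ^ 5) x‖ ^ 2
      - vdiv (fun y => (7 / 8 * (e y ^ 2 * η y ^ 10)) • (a y • gradient u y)) x
      - vdiv (fun y => (5 / 2 * (e y ^ 2 * (η y ^ 9 * a y))) • gradient η y) x
    = 7 / 8 * (e x ^ 2 * η x ^ 10) * -vdiv (fun y => a y • gradient u y) x
      + 5 / 2 * e x ^ 2 * (a x * η x ^ 8 * ‖gradient η x‖ ^ 2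
        - η x ^ 9 * ⟪gradient a x, gradient η x⟫ - a x * η x ^ 9 * vdiv (gradient η) x) := by
  rw [vdiv_fun_smul (by fun_prop) hau, vdiv_fun_smul (by fun_prop) hgη,
    gradient_const_mul (by fun_prop), gradient_const_mul (by fun_prop),
    gradient_fun_mul (by fun_prop) (by fun_prop), gradient_fun_mul (by fun_prop) (by fun_prop),
    gradient_fun_mul (by fun_prop) (by fun_prop), gradient_fun_mul (by fun_prop) (by fun_prop),
    gradient_fun_pow he, gradient_fun_pow hη, gradient_fun_pow hη, gradient_fun_pow hη, heu,
    ← real_inner_self_eq_norm_sq, ← real_inner_self_eq_norm_sq]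
  simp only [inner_add_left, inner_add_right, real_inner_smul_left, real_inner_smul_right,
    real_inner_comm (gradient u x) (gradient η x)]
  push_cast
  ring

theorem pow_seven_mul_le {w η δ : ℝ} (hw : 0 ≤ w) (hη : 0 ≤ η) (hη1 : η ≤ 1) (hδ : 0 ≤ δ) :
    w ^ 7 * η ^ 8 * δ ^ 2 ≤ 1 / 16 * (w ^ 9 * η ^ 10) + 4 ^ 7 * δ ^ 9 := by
  rcases le_total (4 * δ) (w * η) with h | h
  · have h2 : (4 * δ) ^ 2 ≤ (w * η) ^ 2 := by gcongr
    have h3 : w ^ 7 * η ^ 8 * (4 * δ) ^ 2 ≤ w ^ 7 * η ^ 8 * (w * η) ^ 2 := by gcongr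
    have h4 : 0 ≤ 4 ^ 7 * δ ^ 9 := by positivity
    linarith
  · have h2 : (w * η) ^ 7 ≤ (4 * δ) ^ 7 := by gcongr
    have h3 : (w * η) ^ 7 * η * δ ^ 2 ≤ (4 * δ) ^ 7 * 1 * δ ^ 2 := by gcongr
    have h4 : 0 ≤ 1 / 16 * (w ^ 9 * η ^ 10) := by positivity
    linarith

theorem cutoff_error_le {a b C K R η g ι d : ℝ} (ha : 0 ≤ a) (hb : 0 ≤ b) (hC : 0 ≤ C)
    (hK : 0 ≤ K) (hR : 1 ≤ R) (hη : 0 ≤ η) (hη1 : η ≤ 1) (hab : a ≤ C * b) (hg : 0 ≤ g)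
    (hgK : g ≤ K / R) (hι : |ι| ≤ C * b * (K / R)) (hd : |d| ≤ K / R) :
    5 / 2 * (a * η ^ 8 * g ^ 2 - η ^ 9 * ι - a * η ^ 9 * d)
      ≤ b * η ^ 8 * (5 / 2 * C * (K ^ 2 + 2 * K) / R) := by
  have hR0 : 0 < R := one_pos.trans_le hR
  have h98 : η ^ 9 ≤ η ^ 8 := pow_le_pow_of_le_one hη hη1 (by norm_num)
  have hg2 : g ^ 2 ≤ K ^ 2 / R := by
    calc g ^ 2 ≤ (K / R) ^ 2 := by gcongr
      _ = K ^ 2 / R / R := by rw [div_pow]; ring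
      _ ≤ K ^ 2 / R := div_le_self (by positivity) hR
  have h1 : a * η ^ 8 * g ^ 2 ≤ C * b * η ^ 8 * (K ^ 2 / R) := by gcongr
  have h2 : η ^ 9 * -ι ≤ η ^ 8 * (C * b * (K / R)) :=
    (mul_le_mul_of_nonneg_left ((neg_le_abs ι).trans hι) (by positivity)).trans (by gcongr)
  have h3 : a * η ^ 9 * -d ≤ C * b * η ^ 8 * (K / R) :=
    (mul_le_mul_of_nonneg_left ((neg_le_abs d).trans hd) (by positivity)).trans (by gcongr)
  calc _ ≤ 5 / 2 * (C * b * η ^ 8 * (K ^ 2 / R) + η ^ 8 * (C * b * (K / R))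
        + C * b * η ^ 8 * (K / R)) := by linarith
    _ = _ := by ring

/-- The weighted integral of `exp (9 * u / 2)` over the unit ball decays like `1 / ρ`. -/
theorem exists_integral_le_div (hN4 : N ≤ 4) {ω₁ ω₂ u : EuclideanSpace ℝ (Fin N) → ℝ}
    (hω₁ : ContDiff ℝ 1 ω₁) (hω₂ : Continuous ω₂)
    (hω₁pos : ∀ x, 0 < ω₁ x) (hω₂pos : ∀ x, 0 < ω₂ x) {M : ℝ} (hM : ∀ x, ω₂ x ≤ M)
    {C R₀ : ℝ} (hC : 0 < C) (hcomp : ∀ x : EuclideanSpace ℝ (Fin N), R₀ ≤ ‖x‖ →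
      ω₁ x ≤ C * ω₂ x ∧ ‖gradient ω₁ x‖ ≤ C * ω₂ x)
    (hu : ContDiff ℝ 2 u)
    (hsub : ∀ x, -vdiv (fun y => ω₁ y • gradient u y) x ≤ ω₂ x * Real.exp (u x))
    (hstab : ∀ ψ : EuclideanSpace ℝ (Fin N) → ℝ, ContDiff ℝ 2 ψ → HasCompactSupport ψ →
      ∫ x, ω₂ x * Real.exp (u x) * ψ x ^ 2 ≤ ∫ x, ω₁ x * ‖gradient ψ x‖ ^ 2) :
    ∃ B : ℝ, ∀ ρ : ℝ, 1 ≤ ρ → R₀ ≤ ρ →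
      ∫ x in Metric.closedBall (0 : EuclideanSpace ℝ (Fin N)) 1,
        ω₂ x * Real.exp (u x / 2) ^ 9 ≤ B / ρ := by
  obtain ⟨K, hK, hcut⟩ := exists_cutoff N
  set L : ℝ := 5 / 2 * C * (K ^ 2 + 2 * K)
  have hL0 : 0 ≤ L := by positivity
  have hM0 : 0 ≤ M := (hω₂pos 0).le.trans (hM 0)
  set v : ℝ := volume.real (Metric.ball (0 : EuclideanSpace ℝ (Fin N)) 1)
  refine ⟨16 * (16 * v * (M * (4 ^ 7 * √L ^ 9))), fun ρ hρ hρR => ?_⟩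
  have hρ0 : 0 < ρ := one_pos.trans_le hρ
  have hρ2 : 1 ≤ ρ ^ 2 := one_le_pow₀ hρ
  have hρρ : ρ ≤ ρ ^ 2 := by nlinarith
  obtain ⟨η, hη, hηc, hη01, hη1, hη0, hgη, hdη, hzero⟩ := hcut (ρ ^ 2) hρ2
  set e : EuclideanSpace ℝ (Fin N) → ℝ := fun y => Real.exp (7 / 4 * u y) with he_def
  set w : EuclideanSpace ℝ (Fin N) → ℝ := fun y => Real.exp (u y / 2) with hw_def
  have hη2 : ContDiff ℝ 2 η := hη.of_le (by norm_cast)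
  have hη1' : ContDiff ℝ 1 η := hη.of_le (by norm_cast)
  have hggη : ContDiff ℝ 1 (gradient η) := hη.gradient_right (by norm_cast)
  have hu1 : ContDiff ℝ 1 u := hu.of_le (by norm_num)
  have hgu : ContDiff ℝ 1 (gradient u) := hu.gradient_right (by norm_num)
  have he : ContDiff ℝ 2 e := by fun_prop
  have he1 : ContDiff ℝ 1 e := by fun_prop
  have hw : Continuous w := by fun_prop
  have hew (x : EuclideanSpace ℝ (Fin N)) : e x ^ 2 = w x ^ 7 := by
    simp only [he_def, hw_def, ← Real.exp_nat_mul]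
    push_cast
    ring_nf
  have huw (x : EuclideanSpace ℝ (Fin N)) : Real.exp (u x) = w x ^ 2 := by
    simp only [hw_def, ← Real.exp_nat_mul]
    push_cast
    ring_nf
  have hψ : ContDiff ℝ 2 fun y => e y * η y ^ 5 := by fun_prop
  have hpow (n : ℕ) (hn : n ≠ 0) : HasCompactSupport fun y => η y ^ n :=
    hηc.comp_left (g := fun t : ℝ => t ^ n) (zero_pow hn)
  have hψc : HasCompactSupport fun y => e y * η y ^ 5 := (hpow 5 (by norm_num)).mul_left
  set V := fun y => (7 / 8 * (e y ^ 2 * η y ^ 10)) • (ω₁ y • gradient u y) with hV_def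
  set W := fun y => (5 / 2 * (e y ^ 2 * (η y ^ 9 * ω₁ y))) • gradient η y with hW_def
  have hau : ContDiff ℝ 1 fun y => ω₁ y • gradient u y := hω₁.smul hgu
  have hV : ContDiff ℝ 1 V := by
    have h : ContDiff ℝ 1 fun y => 7 / 8 * (e y ^ 2 * η y ^ 10) := by fun_prop
    exact h.smul hau
  have hW : ContDiff ℝ 1 W := by
    have h : ContDiff ℝ 1 fun y => 5 / 2 * (e y ^ 2 * (η y ^ 9 * ω₁ y)) := by fun_prop
    exact h.smul hggη
  have hVc : HasCompactSupport V := by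
    refine (hpow 10 (by norm_num)).mono fun x hx h => hx ?_
    simp only [hV_def, h, mul_zero, zero_smul]
  have hWc : HasCompactSupport W := by
    refine (hpow 9 (by norm_num)).mono fun x hx h => hx ?_
    simp only [hW_def, h, zero_mul, mul_zero, zero_smul]
  have hiV : Integrable (vdiv V) :=
    (continuous_vdiv hV).integrable_of_hasCompactSupport (hasCompactSupport_vdiv hVc)
  have hiW : Integrable (vdiv W) :=
    (continuous_vdiv hW).integrable_of_hasCompactSupport (hasCompactSupport_vdiv hWc)
  have hgψc : HasCompactSupport fun x => ω₁ x * ‖gradient (fun y => e y * η y ^ 5) x‖ ^ 2 := by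
    refine (hψc.fderiv (𝕜 := ℝ)).mono fun x hx h => hx ?_
    simp [gradient, h]
  have hiψ : Integrable fun x => ω₁ x * ‖gradient (fun y => e y * η y ^ 5) x‖ ^ 2 := by
    have hgψ : Continuous (gradient fun y => e y * η y ^ 5) :=
      (hψ.gradient_right (m := 1) (by norm_num)).continuous
    exact (hω₁.continuous.mul (hgψ.norm.pow 2)).integrable_of_hasCompactSupport hgψc
  have hiψV : Integrable fun x =>
      ω₁ x * ‖gradient (fun y => e y * η y ^ 5) x‖ ^ 2 - vdiv V x := hiψ.sub hiV
  set F : EuclideanSpace ℝ (Fin N) → ℝ := fun x => ω₂ x * (w x ^ 9 * η x ^ 10) with hF_def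
  have hF0 (x : EuclideanSpace ℝ (Fin N)) : 0 ≤ F x := by
    have := (hω₂pos x).le
    have := (hη01 x).1
    positivity
  have hiF : Integrable F := by
    refine Continuous.integrable_of_hasCompactSupport ?_
      ((hpow 10 (by norm_num)).mul_left.mul_left)
    have := hη.continuous
    fun_prop
  set ball := Metric.closedBall (0 : EuclideanSpace ℝ (Fin N)) (2 * ρ ^ 2)
  set δ := √L / ρ with hδ_def
  have hδ0 : 0 ≤ δ := by positivity
  have hδ : L / ρ ^ 2 = δ ^ 2 := by rw [hδ_def, div_pow, Real.sq_sqrt hL0]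
  have hpoint (x : EuclideanSpace ℝ (Fin N)) :
      ω₁ x * ‖gradient (fun y => e y * η y ^ 5) x‖ ^ 2 - vdiv V x - vdiv W x
        ≤ 15 / 16 * F x + ball.indicator (fun _ => M * (4 ^ 7 * δ ^ 9)) x := by
    have heu : gradient e x = (7 / 4 * e x) • gradient u x := by
      have hd := hu1.differentiable one_ne_zero x
      rw [he_def, gradient_exp (by fun_prop), gradient_const_mul hd, smul_smul, mul_comm]
    rw [energy_identity x (hω₁.differentiable one_ne_zero x) (he1.differentiable one_ne_zero x)
      (hη1'.differentiable one_ne_zero x) (hau.differentiable one_ne_zero x)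
      (hggη.differentiable one_ne_zero x) heu]
    have hb := hω₂pos x
    obtain ⟨hηx0, hηx1⟩ := hη01 x
    have hwx : 0 ≤ w x := (Real.exp_pos _).le
    have hind : 0 ≤ ball.indicator (fun _ => M * (4 ^ 7 * δ ^ 9)) x :=
      Set.indicator_nonneg (fun _ _ => by positivity) x
    have h1 : 7 / 8 * (e x ^ 2 * η x ^ 10) * -vdiv (fun y => ω₁ y • gradient u y) x
        ≤ 7 / 8 * F x := by
      calc _ ≤ 7 / 8 * (e x ^ 2 * η x ^ 10) * (ω₂ x * Real.exp (u x)) := by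
            gcongr
            exact hsub x
        _ = 7 / 8 * F x := by rw [hew, huw, hF_def]; ring
    suffices h2 : 5 / 2 * e x ^ 2 * (ω₁ x * η x ^ 8 * ‖gradient η x‖ ^ 2
        - η x ^ 9 * ⟪gradient ω₁ x, gradient η x⟫ - ω₁ x * η x ^ 9 * vdiv (gradient η) x)
        ≤ 1 / 16 * F x + ball.indicator (fun _ => M * (4 ^ 7 * δ ^ 9)) x by linarith
    have hrhs : 0 ≤ 1 / 16 * F x + ball.indicator (fun _ => M * (4 ^ 7 * δ ^ 9)) x :=
      add_nonneg (mul_nonneg (by norm_num) (hF0 x)) hind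
    rcases lt_or_ge ‖x‖ (ρ ^ 2) with hx | hx
    · obtain ⟨hz1, hz2⟩ := hzero x hx
      rw [hz1, hz2]
      simp only [norm_zero, inner_zero_right]
      exact le_trans (b := 0) (le_of_eq (by ring)) hrhs
    rcases lt_or_ge (2 * ρ ^ 2) ‖x‖ with hx2 | hx2
    · rw [hη0 x hx2.le]
      exact le_trans (b := 0) (le_of_eq (by ring)) hrhs
    obtain ⟨hab, hgab⟩ := hcomp x (hρR.trans (hρρ.trans hx))
    have herr := cutoff_error_le (ι := ⟪gradient ω₁ x, gradient η x⟫) (hω₁pos x).le hb.le hC.le hK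
      hρ2 hηx0 hηx1 hab (norm_nonneg _) (hgη x)
      ((abs_real_inner_le_norm _ _).trans (mul_le_mul hgab (hgη x) (norm_nonneg _)
        (by positivity))) (hdη x)
    rw [Set.indicator_of_mem (mem_closedBall_zero_iff.2 hx2)]
    calc _ = w x ^ 7 * (5 / 2 * (ω₁ x * η x ^ 8 * ‖gradient η x‖ ^ 2
          - η x ^ 9 * ⟪gradient ω₁ x, gradient η x⟫
          - ω₁ x * η x ^ 9 * vdiv (gradient η) x)) := by rw [hew]; ring
      _ ≤ w x ^ 7 * (ω₂ x * η x ^ 8 * (L / ρ ^ 2)) := by gcongr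
      _ = ω₂ x * (w x ^ 7 * η x ^ 8 * δ ^ 2) := by rw [hδ]; ring
      _ ≤ ω₂ x * (1 / 16 * (w x ^ 9 * η x ^ 10) + 4 ^ 7 * δ ^ 9) := by
          gcongr
          exact pow_seven_mul_le hwx hηx0 hηx1 hδ0
      _ = 1 / 16 * F x + ω₂ x * (4 ^ 7 * δ ^ 9) := by rw [hF_def]; ring
      _ ≤ 1 / 16 * F x + M * (4 ^ 7 * δ ^ 9) := by
          gcongr
          exact hM x
  have hfin : volume ball ≠ ⊤ := measure_closedBall_lt_top.ne
  have hiI : Integrable (ball.indicator fun _ => M * (4 ^ 7 * δ ^ 9)) :=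
    (integrable_indicator_iff Metric.isClosed_closedBall.measurableSet).2
      (integrableOn_const hfin)
  have hmain : ∫ x, F x ≤ 15 / 16 * (∫ x, F x) + volume.real ball * (M * (4 ^ 7 * δ ^ 9)) := by
    calc ∫ x, F x = ∫ x, ω₂ x * Real.exp (u x) * (e x * η x ^ 5) ^ 2 := by
          refine integral_congr_ae (.of_forall fun x => ?_)
          simp only [mul_pow, hew, huw, hF_def]
          ring
      _ ≤ ∫ x, ω₁ x * ‖gradient (fun y => e y * η y ^ 5) x‖ ^ 2 := hstab _ hψ hψc
      _ = ∫ x, (ω₁ x * ‖gradient (fun y => e y * η y ^ 5) x‖ ^ 2 - vdiv V x - vdiv W x) := by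
          rw [integral_sub hiψV hiW, integral_sub hiψ hiV, integral_vdiv_eq_zero hV hVc,
            integral_vdiv_eq_zero hW hWc, sub_zero, sub_zero]
      _ ≤ ∫ x, (15 / 16 * F x + ball.indicator (fun _ => M * (4 ^ 7 * δ ^ 9)) x) :=
          integral_mono (hiψV.sub hiW) ((hiF.const_mul _).add hiI) hpoint
      _ = _ := by
          rw [integral_add (hiF.const_mul _) hiI, integral_const_mul,
            integral_indicator Metric.isClosed_closedBall.measurableSet, setIntegral_const,
            smul_eq_mul]
  have hvol : volume.real ball ≤ 16 * ρ ^ 8 * v := by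
    have hpow2 : (2 * ρ ^ 2) ^ N ≤ (2 * ρ ^ 2) ^ 4 := pow_le_pow_right₀ (by linarith) hN4
    have hv : volume.real ball = (2 * ρ ^ 2) ^ N * v := by
      rw [Measure.real, Measure.addHaar_closedBall _ _ (by positivity), ENNReal.toReal_mul,
        ENNReal.toReal_ofReal (by positivity), finrank_euclideanSpace_fin]
      rfl
    rw [hv]
    calc (2 * ρ ^ 2) ^ N * v ≤ (2 * ρ ^ 2) ^ 4 * v := by gcongr
      _ = 16 * ρ ^ 8 * v := by ring
  have hlow : ∫ x in Metric.closedBall (0 : EuclideanSpace ℝ (Fin N)) 1, ω₂ x * w x ^ 9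
      ≤ ∫ x, F x := by
    calc _ = ∫ x in Metric.closedBall (0 : EuclideanSpace ℝ (Fin N)) 1, F x := by
          refine setIntegral_congr_fun Metric.isClosed_closedBall.measurableSet fun x hx => ?_
          simp only [hF_def, hη1 x ((mem_closedBall_zero_iff.1 hx).trans hρ2), one_pow, mul_one]
      _ ≤ _ := setIntegral_le_integral hiF (.of_forall hF0)
  calc _ ≤ ∫ x, F x := hlow
    _ ≤ 16 * (volume.real ball * (M * (4 ^ 7 * δ ^ 9))) := by linarith
    _ ≤ 16 * (16 * ρ ^ 8 * v * (M * (4 ^ 7 * δ ^ 9))) := by gcongr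
    _ = _ := by
        rw [hδ_def]
        field_simp

theorem stmt_12 (N : ℕ) (hN : 1 ≤ N) (hN4 : N ≤ 4)
    (ω₁ ω₂ : EuclideanSpace ℝ (Fin N) → ℝ)
    (hω₁ : ContDiff ℝ (⊤ : ℕ∞) ω₁) (hω₂ : ContDiff ℝ (⊤ : ℕ∞) ω₂)
    (hω₁pos : ∀ x, 0 < ω₁ x) (hω₂pos : ∀ x, 0 < ω₂ x)
    (hbdd : ∃ M : ℝ, ∀ x, ω₂ x ≤ M)
    (hcomp : ∃ C : ℝ, 0 < C ∧ ∃ R₀ : ℝ, ∀ x : EuclideanSpace ℝ (Fin N), R₀ ≤ ‖x‖ →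
      ω₁ x ≤ C * ω₂ x ∧ ‖gradient ω₁ x‖ ≤ C * ω₂ x) :
    ¬ ∃ u : EuclideanSpace ℝ (Fin N) → ℝ, ContDiff ℝ 2 u ∧
      (∀ x, -vdiv (fun y => ω₁ y • gradient u y) x ≤ ω₂ x * Real.exp (u x)) ∧
      (∀ ψ : EuclideanSpace ℝ (Fin N) → ℝ, ContDiff ℝ 2 ψ → HasCompactSupport ψ →
        ∫ x, ω₂ x * Real.exp (u x) * ψ x ^ 2 ≤ ∫ x, ω₁ x * ‖gradient ψ x‖ ^ 2) := by
  rintro ⟨u, hu, hsub, hstab⟩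
  obtain ⟨M, hM⟩ := hbdd
  obtain ⟨C, hC, R₀, hcomp⟩ := hcomp
  obtain ⟨B, hB⟩ := exists_integral_le_div hN4 (hω₁.of_le (by norm_cast)) hω₂.continuous hω₁pos
    hω₂pos hM hC hcomp hu hsub hstab
  have hpos (x : EuclideanSpace ℝ (Fin N)) : 0 < ω₂ x * Real.exp (u x / 2) ^ 9 :=
    mul_pos (hω₂pos x) (by positivity)
  have hcont : Continuous fun x => ω₂ x * Real.exp (u x / 2) ^ 9 := by
    have := hω₂.continuous
    have := hu.continuous
    fun_prop
  have hint : 0 < ∫ x in Metric.closedBall (0 : EuclideanSpace ℝ (Fin N)) 1,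
      ω₂ x * Real.exp (u x / 2) ^ 9 := by
    rw [setIntegral_pos_iff_support_of_nonneg_ae (.of_forall fun x => (hpos x).le)
      (hcont.continuousOn.integrableOn_compact (isCompact_closedBall _ _))]
    rw [Function.support_eq_univ fun x => (hpos x).ne', Set.univ_inter]
    exact Metric.measure_closedBall_pos _ _ one_pos
  have hlim : Tendsto (fun ρ : ℝ => B / ρ) atTop (nhds 0) := tendsto_const_nhds.div_atTop tendsto_id
  refine hint.not_ge (ge_of_tendsto hlim ?_)
  filter_upwards [eventually_ge_atTop 1, eventually_ge_atTop R₀] with ρ h1 h2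
  exact hB ρ h1 h2
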